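/- Let L ∈ ℝ^{n×q} with ρ(A − LC) < 1 and write M := A − LC. The map L ↦ Σ̄(L) is differentiable at L, and for every direction D ∈ ℝ^{n×q} its directional derivative Σ̇ at L in direction D is the unique solution of Σ̇ = M Σ̇ Mᵀ + D 𝒟ᵀ + 𝒟 Dᵀ, where 𝒟 := (L − L*) S* − M Σ̄(L) Cᵀ. Consequently, the directional derivative of V̄ at L in direction D equals Tr( W C Σ̇ Cᵀ ), and for the particular choice D = 𝒟 one has Σ̇ = M Σ̇ Mᵀ + 2 𝒟 𝒟ᵀ and C Σ̇ Cᵀ = 2 ∑_{i=0}^∞ (C M^i 𝒟)(C M^i 𝒟)ᵀ ⪰ 0. -/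

import Mathlib

open Matrix

attribute [local instance] Matrix.frobeniusNormedAddCommGroup Matrix.frobeniusNormedSpace

/-- Spectral radius of a real matrix, computed from its complex spectrum. -/
noncomputable def specRadius {a : ℕ} (M : Matrix (Fin a) (Fin a) ℝ) : ENNReal :=
  spectralRadius ℂ (M.map Complex.ofReal)

/-- Steady-state error covariance `Σ̄(L)`. -/
noncomputable def Sigmabar {n q : ℕ} (A : Matrix (Fin n) (Fin n) ℝ)
    (C : Matrix (Fin q) (Fin n) ℝ) (Lstar : Matrix (Fin n) (Fin q) ℝ)
    (Sstar : Matrix (Fin q) (Fin q) ℝ) (L : Matrix (Fin n) (Fin q) ℝ) :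
    Matrix (Fin n) (Fin n) ℝ :=
  ∑' i : ℕ, (A - L * C) ^ i * ((L - Lstar) * Sstar * (L - Lstar)ᵀ) * ((A - L * C)ᵀ) ^ i

/-- Asymptotic objective `V̄(L) = Tr(W (S* + C Σ̄(L) Cᵀ))`. -/
noncomputable def Vbar {n q : ℕ} (A : Matrix (Fin n) (Fin n) ℝ)
    (C : Matrix (Fin q) (Fin n) ℝ) (Lstar : Matrix (Fin n) (Fin q) ℝ)
    (Sstar W : Matrix (Fin q) (Fin q) ℝ) (L : Matrix (Fin n) (Fin q) ℝ) : ℝ :=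
  (W * (Sstar + C * Sigmabar A C Lstar Sstar L * Cᵀ)).trace

/-- The special direction `𝒟 = (L − L*) S* − (A − LC) Σ̄(L) Cᵀ`. -/
noncomputable def Dcal {n q : ℕ} (A : Matrix (Fin n) (Fin n) ℝ)
    (C : Matrix (Fin q) (Fin n) ℝ) (Lstar : Matrix (Fin n) (Fin q) ℝ)
    (Sstar : Matrix (Fin q) (Fin q) ℝ) (L : Matrix (Fin n) (Fin q) ℝ) :
    Matrix (Fin n) (Fin q) ℝ :=
  (L - Lstar) * Sstar - (A - L * C) * Sigmabar A C Lstar Sstar L * Cᵀ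

section helpers

open Filter Topology

attribute [local instance] Matrix.frobeniusNormedRing Matrix.frobeniusNormedAlgebra

lemma aux_nnnorm_map_pow {n : ℕ} (M : Matrix (Fin n) (Fin n) ℝ) (i : ℕ) :
    ‖(M.map Complex.ofReal) ^ i‖₊ = ‖M ^ i‖₊ := by
  have h : (M.map Complex.ofReal) ^ i = (M ^ i).map Complex.ofReal :=
    (map_pow (Complex.ofRealHom.mapMatrix (m := Fin n)) M i).symm
  rw [h]
  exact Matrix.frobenius_nnnorm_map_eq _ _ (fun a => by simp)

lemma aux_powbound {n : ℕ} (M : Matrix (Fin n) (Fin n) ℝ) (h : specRadius M < 1) :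
    ∃ r : ℝ, 0 ≤ r ∧ r < 1 ∧ ∀ᶠ i : ℕ in atTop, ‖M ^ i‖ ≤ r ^ i := by
  have hT := spectrum.pow_nnnorm_pow_one_div_tendsto_nhds_spectralRadius (M.map Complex.ofReal)
  obtain ⟨r, hr1, hr2⟩ := ENNReal.lt_iff_exists_nnreal_btwn.1 h
  refine ⟨r, r.2, by exact_mod_cast hr2, ?_⟩
  filter_upwards [hT.eventually_lt_const hr1, eventually_gt_atTop 0] with i hi hi0
  rw [aux_nnnorm_map_pow] at hi
  have hi' : (0:ℝ) < i := by exact_mod_cast hi0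
  have h2 := ENNReal.rpow_le_rpow hi.le hi'.le
  rw [← ENNReal.rpow_mul, one_div_mul_cancel hi'.ne', ENNReal.rpow_one, ENNReal.rpow_natCast] at h2
  have h3 : ‖M ^ i‖₊ ≤ r ^ i := by exact_mod_cast h2
  exact_mod_cast h3

lemma aux_open {n : ℕ} (M : Matrix (Fin n) (Fin n) ℝ) (h : specRadius M < 1) :
    ∀ᶠ M' in 𝓝 M, specRadius M' < 1 := by
  obtain ⟨r, hr0, hr1, hev⟩ := aux_powbound M h
  have ht : Tendsto (fun i : ℕ => r ^ i * ‖(1 : Matrix (Fin n) (Fin n) ℝ)‖) atTop (𝓝 (0 * _)) :=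
    (tendsto_pow_atTop_nhds_zero_of_lt_one hr0 hr1).mul_const _
  rw [zero_mul] at ht
  obtain ⟨k, hk⟩ := ((hev.and (ht.eventually_lt_const one_pos)).and
    (eventually_gt_atTop 0)).exists
  obtain ⟨⟨hk1, hk2⟩, hk0⟩ := hk
  obtain ⟨m, rfl⟩ : ∃ m, k = m + 1 := ⟨k - 1, by omega⟩
  have hlt : ‖M ^ (m + 1)‖ * ‖(1 : Matrix (Fin n) (Fin n) ℝ)‖ < 1 :=
    lt_of_le_of_lt (mul_le_mul_of_nonneg_right hk1 (norm_nonneg _)) hk2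
  have hc : Continuous fun M' : Matrix (Fin n) (Fin n) ℝ =>
      ‖M' ^ (m + 1)‖ * ‖(1 : Matrix (Fin n) (Fin n) ℝ)‖ := by fun_prop
  filter_upwards [hc.continuousAt.eventually_lt_const hlt] with M' hM'
  have h1 := spectrum.spectralRadius_le_pow_nnnorm_pow_one_div ℂ (M'.map Complex.ofReal) m
  have h0 := aux_nnnorm_map_pow M' 0
  rw [pow_zero, pow_zero] at h0
  rw [aux_nnnorm_map_pow, h0, ← ENNReal.mul_rpow_of_nonneg _ _ (by positivity)] at h1
  refine lt_of_le_of_lt h1 (ENNReal.rpow_lt_one ?_ (by positivity))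
  have : ‖M' ^ (m + 1)‖₊ * ‖(1 : Matrix (Fin n) (Fin n) ℝ)‖₊ < 1 := by exact_mod_cast hM'
  exact_mod_cast this

lemma aux_summable {n : ℕ} (M : Matrix (Fin n) (Fin n) ℝ) (h : specRadius M < 1)
    (Q : Matrix (Fin n) (Fin n) ℝ) : Summable (fun i : ℕ => M ^ i * Q * Mᵀ ^ i) := by
  obtain ⟨r, hr0, hr1, hev⟩ := aux_powbound M h
  refine Summable.of_norm_bounded_eventually_nat (g := fun i => ‖Q‖ * (r * r) ^ i) ?_ ?_
  · exact (summable_geometric_of_lt_one (by positivity) (by nlinarith)).mul_left _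
  · filter_upwards [hev] with i hi
    have hi' : ‖Mᵀ ^ i‖ ≤ r ^ i := by
      rw [← Matrix.transpose_pow, Matrix.frobenius_norm_transpose]; exact hi
    calc ‖M ^ i * Q * Mᵀ ^ i‖ ≤ ‖M ^ i‖ * ‖Q‖ * ‖Mᵀ ^ i‖ :=
          (norm_mul_le _ _).trans (mul_le_mul_of_nonneg_right (norm_mul_le _ _) (norm_nonneg _))
      _ ≤ r ^ i * ‖Q‖ * r ^ i := by gcongr
      _ = ‖Q‖ * (r * r) ^ i := by rw [mul_pow]; ring

lemma aux_lyap {n : ℕ} (M : Matrix (Fin n) (Fin n) ℝ) (h : specRadius M < 1)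
    (Q : Matrix (Fin n) (Fin n) ℝ) :
    (∑' i : ℕ, M ^ i * Q * Mᵀ ^ i) = M * (∑' i : ℕ, M ^ i * Q * Mᵀ ^ i) * Mᵀ + Q := by
  have hs := aux_summable M h Q
  conv_lhs => rw [hs.tsum_eq_zero_add]
  have h2 : ∀ i : ℕ, M ^ (i+1) * Q * Mᵀ ^ (i+1) = M * (M ^ i * Q * Mᵀ ^ i) * Mᵀ := by
    intro i
    rw [pow_succ', pow_succ]; simp only [mul_assoc]
  simp_rw [h2]
  rw [(hs.mul_left M).tsum_mul_right, hs.tsum_mul_left]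
  simp [add_comm]

lemma aux_unique {n : ℕ} (M : Matrix (Fin n) (Fin n) ℝ) (h : specRadius M < 1)
    (X : Matrix (Fin n) (Fin n) ℝ) (hX : X = M * X * Mᵀ) : X = 0 := by
  have h2 : ∀ i : ℕ, M ^ i * X * Mᵀ ^ i = X := by
    intro i
    induction i with
    | zero => simp
    | succ i ih =>
      calc _ = M ^ i * (M * X * Mᵀ) * Mᵀ ^ i := by
            rw [pow_succ, pow_succ']; simp only [mul_assoc]
        _ = X := by rw [← hX, ih]
  have := (aux_summable M h X).tendsto_atTop_zero
  simp_rw [h2] at this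
  exact tendsto_nhds_unique tendsto_const_nhds this

lemma aux_unique' {n : ℕ} (M : Matrix (Fin n) (Fin n) ℝ) (h : specRadius M < 1)
    (X Y Q : Matrix (Fin n) (Fin n) ℝ) (hX : X = M * X * Mᵀ + Q) (hY : Y = M * Y * Mᵀ + Q) :
    X = Y := by
  rw [← sub_eq_zero]
  apply aux_unique M h
  rw [Matrix.mul_sub, Matrix.sub_mul]
  nth_rewrite 1 [hX, hY]
  abel

/-- conjugation operator -/
noncomputable def auxT {n : ℕ} (M : Matrix (Fin n) (Fin n) ℝ) :
    Matrix (Fin n) (Fin n) ℝ →L[ℝ] Matrix (Fin n) (Fin n) ℝ :=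
  (ContinuousLinearMap.mul ℝ _ M).comp ((ContinuousLinearMap.mul ℝ _).flip Mᵀ)

lemma auxT_apply {n : ℕ} (M X : Matrix (Fin n) (Fin n) ℝ) : auxT M X = M * X * Mᵀ := by
  rw [mul_assoc]; rfl

lemma aux_isUnit {n : ℕ} (M : Matrix (Fin n) (Fin n) ℝ) (h : specRadius M < 1) :
    IsUnit (1 - auxT M) := by
  refine ContinuousLinearMap.isUnit_iff_bijective.2 ?_
  have hinj : Function.Injective
      ((1 - auxT M : Matrix (Fin n) (Fin n) ℝ →L[ℝ] Matrix (Fin n) (Fin n) ℝ)) := by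
    rw [injective_iff_map_eq_zero]
    intro X hX
    apply aux_unique M h
    rw [← auxT_apply]
    exact sub_eq_zero.1 hX
  refine ⟨hinj, ?_⟩
  exact LinearMap.injective_iff_surjective (f := (1 - auxT M : Matrix (Fin n) (Fin n) ℝ →L[ℝ] Matrix (Fin n) (Fin n) ℝ).toLinearMap) |>.1 hinj

lemma aux_trans_diff {n q : ℕ} : Differentiable ℝ (fun X : Matrix (Fin n) (Fin q) ℝ => Xᵀ) :=
  (LinearMap.toContinuousLinearMap
    (Matrix.transposeLinearEquiv (Fin n) (Fin q) ℝ ℝ).toLinearMap).differentiable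

/-- multiplication as a continuous bilinear map -/
noncomputable def auxB (a b c : ℕ) : Matrix (Fin a) (Fin b) ℝ →L[ℝ]
    Matrix (Fin b) (Fin c) ℝ →L[ℝ] Matrix (Fin a) (Fin c) ℝ :=
  (LinearMap.mk₂ ℝ (fun X Y => X * Y) Matrix.add_mul (fun r X Y => Matrix.smul_mul r X Y)
    Matrix.mul_add (fun r X Y => Matrix.mul_smul X r Y)).mkContinuous₂ 1
    (fun X Y => by simpa using Matrix.frobenius_norm_mul X Y)

lemma auxB_apply {a b c : ℕ} (X : Matrix (Fin a) (Fin b) ℝ) (Y : Matrix (Fin b) (Fin c) ℝ) :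
    auxB a b c X Y = X * Y := rfl

lemma aux_hasDeriv_mul {a b c : ℕ} {E : Type*} [NormedAddCommGroup E] [NormedSpace ℝ E]
    {f : E → Matrix (Fin a) (Fin b) ℝ} {g : E → Matrix (Fin b) (Fin c) ℝ} {x : E}
    {f' : E →L[ℝ] Matrix (Fin a) (Fin b) ℝ} {g' : E →L[ℝ] Matrix (Fin b) (Fin c) ℝ}
    (hf : HasFDerivAt f f' x) (hg : HasFDerivAt g g' x) :
    ∃ Φ : E →L[ℝ] Matrix (Fin a) (Fin c) ℝ,
      HasFDerivAt (fun y => f y * g y) Φ x ∧ ∀ d, Φ d = f x * g' d + f' d * g x :=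
  ⟨_, (auxB a b c).hasFDerivAt_of_bilinear hf hg, fun _ => rfl⟩

lemma aux_auxT_diff {n : ℕ} : Differentiable ℝ (fun M : Matrix (Fin n) (Fin n) ℝ => auxT M) := by
  unfold auxT
  have h1 : Differentiable ℝ (fun M : Matrix (Fin n) (Fin n) ℝ =>
      ContinuousLinearMap.mul ℝ (Matrix (Fin n) (Fin n) ℝ) M) :=
    (ContinuousLinearMap.mul ℝ (Matrix (Fin n) (Fin n) ℝ)).differentiable
  have h2 : Differentiable ℝ (fun M : Matrix (Fin n) (Fin n) ℝ =>
      (ContinuousLinearMap.mul ℝ (Matrix (Fin n) (Fin n) ℝ)).flip Mᵀ) :=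
    (ContinuousLinearMap.mul ℝ (Matrix (Fin n) (Fin n) ℝ)).flip.differentiable.comp aux_trans_diff
  exact h1.clm_comp h2

lemma aux_summable_map {n q : ℕ} (M : Matrix (Fin n) (Fin n) ℝ) (h : specRadius M < 1)
    (C : Matrix (Fin q) (Fin n) ℝ) (D : Matrix (Fin n) (Fin q) ℝ) :
    HasSum (fun i : ℕ => (C * M ^ i * D) * (C * M ^ i * D)ᵀ)
      (C * (∑' i : ℕ, M ^ i * (D * Dᵀ) * Mᵀ ^ i) * Cᵀ) := by
  have hs := (aux_summable M h (D * Dᵀ)).hasSum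
  have h2 := ((auxB q n q).flip Cᵀ).hasSum ((auxB q n n C).hasSum hs)
  refine (congrArg (fun f => HasSum f _) (funext fun i => ?_)).mpr h2
  change _ = (C * (M ^ i * (D * Dᵀ) * Mᵀ ^ i)) * Cᵀ
  simp only [Matrix.transpose_mul, Matrix.transpose_pow, Matrix.mul_assoc]

lemma aux_psd {q : ℕ} (f : ℕ → Matrix (Fin q) (Fin q) ℝ) (X : Matrix (Fin q) (Fin q) ℝ)
    (hf : HasSum (fun i => f i * (f i)ᵀ) X) : X.PosSemidef := by
  refine Matrix.PosSemidef.of_dotProduct_mulVec_nonneg ?_ ?_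
  · have h2 := (LinearMap.toContinuousLinearMap
      (Matrix.transposeLinearEquiv (Fin q) (Fin q) ℝ ℝ).toLinearMap).hasSum hf
    have h3 : HasSum (fun i => f i * (f i)ᵀ) Xᵀ := by
      refine (congrArg (fun f => HasSum f _) (funext fun i => ?_)).mpr h2
      change _ = (f i * (f i)ᵀ)ᵀ
      simp
    rw [Matrix.IsHermitian, Matrix.conjTranspose_eq_transpose_of_trivial]
    exact h3.unique hf
  · intro x
    let g : Matrix (Fin q) (Fin q) ℝ →ₗ[ℝ] ℝ :=
      { toFun := fun Y => star x ⬝ᵥ (Y *ᵥ x)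
        map_add' := fun Y Z => by simp [Matrix.add_mulVec]
        map_smul' := fun r Y => by simp [Matrix.smul_mulVec] }
    have h2 := (LinearMap.toContinuousLinearMap g).hasSum hf
    refine h2.nonneg fun i => ?_
    have := (Matrix.posSemidef_self_mul_conjTranspose (f i)).dotProduct_mulVec_nonneg x
    rw [Matrix.conjTranspose_eq_transpose_of_trivial] at this
    exact this

lemma aux_Sigmabar_lyap {n q : ℕ} (A : Matrix (Fin n) (Fin n) ℝ)
    (C : Matrix (Fin q) (Fin n) ℝ) (Lstar : Matrix (Fin n) (Fin q) ℝ)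
    (Sstar : Matrix (Fin q) (Fin q) ℝ) (L : Matrix (Fin n) (Fin q) ℝ)
    (h : specRadius (A - L * C) < 1) :
    Sigmabar A C Lstar Sstar L = (A - L * C) * Sigmabar A C Lstar Sstar L * (A - L * C)ᵀ
      + (L - Lstar) * Sstar * (L - Lstar)ᵀ :=
  aux_lyap (A - L * C) h _

lemma aux_Sigmabar_symm {n q : ℕ} (A : Matrix (Fin n) (Fin n) ℝ)
    (C : Matrix (Fin q) (Fin n) ℝ) (Lstar : Matrix (Fin n) (Fin q) ℝ)
    (Sstar : Matrix (Fin q) (Fin q) ℝ) (hS : Sstarᵀ = Sstar) (L : Matrix (Fin n) (Fin q) ℝ)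
    (h : specRadius (A - L * C) < 1) :
    (Sigmabar A C Lstar Sstar L)ᵀ = Sigmabar A C Lstar Sstar L := by
  have h1 := aux_Sigmabar_lyap A C Lstar Sstar L h
  refine aux_unique' _ h _ _ _ ?_ h1
  have h2 := congrArg Matrix.transpose h1
  simpa only [Matrix.transpose_add, Matrix.transpose_mul, Matrix.transpose_transpose, hS,
    Matrix.mul_assoc] using h2

lemma aux_hasDeriv_M {n q : ℕ} (A : Matrix (Fin n) (Fin n) ℝ)
    (C : Matrix (Fin q) (Fin n) ℝ) (L : Matrix (Fin n) (Fin q) ℝ) :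
    ∃ Φ : Matrix (Fin n) (Fin q) ℝ →L[ℝ] Matrix (Fin n) (Fin n) ℝ,
      HasFDerivAt (fun L' => A - L' * C) Φ L ∧ ∀ D, Φ D = - (D * C) := by
  refine ⟨_, (((auxB n q n).flip C).hasFDerivAt).const_sub A, fun D => rfl⟩

lemma aux_hasDeriv_trans {a b : ℕ} {E : Type*} [NormedAddCommGroup E] [NormedSpace ℝ E]
    {f : E → Matrix (Fin a) (Fin b) ℝ} {x : E}
    {f' : E →L[ℝ] Matrix (Fin a) (Fin b) ℝ} (hf : HasFDerivAt f f' x) :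
    ∃ Φ : E →L[ℝ] Matrix (Fin b) (Fin a) ℝ,
      HasFDerivAt (fun y => (f y)ᵀ) Φ x ∧ ∀ d, Φ d = (f' d)ᵀ :=
  ⟨_, (LinearMap.toContinuousLinearMap
    (Matrix.transposeLinearEquiv (Fin a) (Fin b) ℝ ℝ).toLinearMap).hasFDerivAt.comp x hf,
    fun _ => rfl⟩

lemma aux_hasDeriv_Q {n q : ℕ} (Lstar : Matrix (Fin n) (Fin q) ℝ)
    (S : Matrix (Fin q) (Fin q) ℝ) (L : Matrix (Fin n) (Fin q) ℝ) :
    ∃ Φ : Matrix (Fin n) (Fin q) ℝ →L[ℝ] Matrix (Fin n) (Fin n) ℝ,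
      HasFDerivAt (fun L' => (L' - Lstar) * S * (L' - Lstar)ᵀ) Φ L ∧
      ∀ D, Φ D = (L - Lstar) * S * Dᵀ + D * S * (L - Lstar)ᵀ := by
  have h0 : HasFDerivAt (fun L' : Matrix (Fin n) (Fin q) ℝ => L' - Lstar)
    (ContinuousLinearMap.id ℝ _) L := (hasFDerivAt_id L).sub_const Lstar
  obtain ⟨P1, h1, e1⟩ := aux_hasDeriv_trans h0
  obtain ⟨P2, h2, e2⟩ := aux_hasDeriv_mul h0 (hasFDerivAt_const S L)
  obtain ⟨P3, h3, e3⟩ := aux_hasDeriv_mul h2 h1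
  refine ⟨P3, h3, fun D => ?_⟩
  have e1' : P1 D = Dᵀ := e1 D
  have e2' : P2 D = D * S := by
    refine (e2 D).trans ?_
    change (L - Lstar) * 0 + D * S = _
    rw [Matrix.mul_zero, zero_add]
  refine (e3 D).trans ?_
  exact congrArg₂ (fun X Y => (L - Lstar) * S * X + Y * (L - Lstar)ᵀ) e1' e2'

lemma aux_eventually {n q : ℕ} (A : Matrix (Fin n) (Fin n) ℝ)
    (C : Matrix (Fin q) (Fin n) ℝ) (L : Matrix (Fin n) (Fin q) ℝ)
    (h : specRadius (A - L * C) < 1) : ∀ᶠ L' in 𝓝 L, specRadius (A - L' * C) < 1 := by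
  obtain ⟨P, hP, -⟩ := aux_hasDeriv_M A C L
  exact hP.continuousAt.eventually (aux_open _ h)

lemma aux_inv {E G F : Type*} [NormedAddCommGroup E] [NormedSpace ℝ E] [NormedAddCommGroup G]
    [NormedSpace ℝ G] [NormedAddCommGroup F] [NormedSpace ℝ F] [CompleteSpace F]
    (T : G → F →L[ℝ] F) (m : E → G) (Q : E → F) (x : E) (hT : Differentiable ℝ T)
    (hm : DifferentiableAt ℝ m x) (hQ : DifferentiableAt ℝ Q x) (hu : IsUnit (1 - T (m x))) :
    DifferentiableAt ℝ (fun y => Ring.inverse (1 - T (m y)) (Q y)) x := by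
  have h1 : DifferentiableAt ℝ (fun y => 1 - T (m y)) x :=
    ((hT _).comp x hm).const_sub 1
  have hI := (differentiableAt_inverse (𝕜 := ℝ) hu).comp x h1
  exact hI.clm_apply hQ

lemma aux_diff {n q : ℕ} (A : Matrix (Fin n) (Fin n) ℝ)
    (C : Matrix (Fin q) (Fin n) ℝ) (Lstar : Matrix (Fin n) (Fin q) ℝ)
    (Sstar : Matrix (Fin q) (Fin q) ℝ) (L : Matrix (Fin n) (Fin q) ℝ)
    (h : specRadius (A - L * C) < 1) :
    DifferentiableAt ℝ (fun L' => Sigmabar A C Lstar Sstar L') L := by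
  obtain ⟨P, hP, -⟩ := aux_hasDeriv_M A C L
  obtain ⟨R, hR, -⟩ := aux_hasDeriv_Q Lstar Sstar L
  have hF := aux_inv (fun M : Matrix (Fin n) (Fin n) ℝ => auxT M) _ _ L aux_auxT_diff
    hP.differentiableAt hR.differentiableAt (aux_isUnit _ h)
  refine hF.congr_of_eventuallyEq ?_
  filter_upwards [aux_eventually A C L h] with L' hL'
  have h1 : (1 - auxT (A - L' * C)) (Sigmabar A C Lstar Sstar L')
      = (L' - Lstar) * Sstar * (L' - Lstar)ᵀ := by
    change Sigmabar A C Lstar Sstar L' - auxT (A - L' * C) (Sigmabar A C Lstar Sstar L') = _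
    rw [auxT_apply, sub_eq_iff_eq_add']
    exact aux_Sigmabar_lyap A C Lstar Sstar L' hL'
  have h2 := Ring.inverse_mul_cancel _ (aux_isUnit _ hL')
  change _ = (Ring.inverse (1 - auxT (A - L' * C))) ((L' - Lstar) * Sstar * (L' - Lstar)ᵀ)
  rw [← h1]
  exact (congrArg (fun f : Matrix (Fin n) (Fin n) ℝ →L[ℝ] Matrix (Fin n) (Fin n) ℝ =>
    f (Sigmabar A C Lstar Sstar L')) h2).symm

lemma aux_main_eq {n q : ℕ} (A : Matrix (Fin n) (Fin n) ℝ)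
    (C : Matrix (Fin q) (Fin n) ℝ) (Lstar : Matrix (Fin n) (Fin q) ℝ)
    (Sstar : Matrix (Fin q) (Fin q) ℝ) (hS : Sstarᵀ = Sstar) (L : Matrix (Fin n) (Fin q) ℝ)
    (h : specRadius (A - L * C) < 1)
    (Φ : Matrix (Fin n) (Fin q) ℝ →L[ℝ] Matrix (Fin n) (Fin n) ℝ)
    (hΦ : HasFDerivAt (fun L' => Sigmabar A C Lstar Sstar L') Φ L)
    (D : Matrix (Fin n) (Fin q) ℝ) :
    Φ D = (A - L * C) * Φ D * (A - L * C)ᵀ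
      + D * (Dcal A C Lstar Sstar L)ᵀ + Dcal A C Lstar Sstar L * Dᵀ := by
  obtain ⟨P, hP, eP⟩ := aux_hasDeriv_M A C L
  obtain ⟨R, hR, eR⟩ := aux_hasDeriv_Q Lstar Sstar L
  obtain ⟨P1, h1, e1⟩ := aux_hasDeriv_trans hP
  obtain ⟨P2, h2, e2⟩ := aux_hasDeriv_mul hP hΦ
  obtain ⟨P3, h3, e3⟩ := aux_hasDeriv_mul h2 h1
  have h4 := h3.add hR
  obtain ⟨Ψ, h5, e5⟩ : ∃ Ψ : Matrix (Fin n) (Fin q) ℝ →L[ℝ] Matrix (Fin n) (Fin n) ℝ,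
      HasFDerivAt (fun L' => Sigmabar A C Lstar Sstar L') Ψ L ∧ ∀ D, Ψ D = P3 D + R D := by
    refine ⟨_, h4.congr_of_eventuallyEq ?_, fun _ => rfl⟩
    filter_upwards [aux_eventually A C L h] with L' hL'
    exact aux_Sigmabar_lyap A C Lstar Sstar L' hL'
  have h6 : Φ D = P3 D + R D := (congrArg (fun f => f D) (hΦ.unique h5)).trans (e5 D)
  have e1' : P1 D = (-(D * C))ᵀ := (e1 D).trans (congrArg _ (eP D))
  have e2' : P2 D = (A - L * C) * Φ D + -(D * C) * Sigmabar A C Lstar Sstar L :=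
    (e2 D).trans (congrArg (fun X => (A - L * C) * Φ D + X * Sigmabar A C Lstar Sstar L) (eP D))
  have e3' := (e3 D).trans (congrArg₂ (fun X Y =>
    (A - L * C) * Sigmabar A C Lstar Sstar L * X + Y * (A - L * C)ᵀ) e1' e2')
  replace h6 := h6.trans (congrArg₂ (fun X Y => X + Y) e3' (eR D))
  refine h6.trans ?_
  unfold Dcal
  have hs := aux_Sigmabar_symm A C Lstar Sstar hS L h
  generalize Sigmabar A C Lstar Sstar L = X at hs ⊢
  generalize Φ D = Y
  generalize A - L * C = M
  generalize L - Lstar = N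
  simp only [Matrix.transpose_sub, Matrix.transpose_mul, hs, hS, Matrix.transpose_transpose,
    Matrix.transpose_neg, Matrix.mul_neg, Matrix.neg_mul, Matrix.mul_sub, Matrix.sub_mul,
    Matrix.add_mul, Matrix.mul_assoc]
  abel

lemma aux_Vbar {n q : ℕ} (A : Matrix (Fin n) (Fin n) ℝ)
    (C : Matrix (Fin q) (Fin n) ℝ) (Lstar : Matrix (Fin n) (Fin q) ℝ)
    (Sstar W : Matrix (Fin q) (Fin q) ℝ) (L : Matrix (Fin n) (Fin q) ℝ)
    (Φ : Matrix (Fin n) (Fin q) ℝ →L[ℝ] Matrix (Fin n) (Fin n) ℝ)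
    (hΦ : HasFDerivAt (fun L' => Sigmabar A C Lstar Sstar L') Φ L)
    (D : Matrix (Fin n) (Fin q) ℝ) :
    fderiv ℝ (Vbar A C Lstar Sstar W) L D = (W * C * Φ D * Cᵀ).trace := by
  let g : Matrix (Fin n) (Fin n) ℝ →ₗ[ℝ] ℝ :=
    { toFun := fun Y => (W * C * Y * Cᵀ).trace
      map_add' := fun Y Z => by simp [Matrix.mul_add, Matrix.add_mul]
      map_smul' := fun r Y => by simp }
  have h1 := ((LinearMap.toContinuousLinearMap g).hasFDerivAt.comp L hΦ).const_add
    (W * Sstar).trace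
  have h2 : HasFDerivAt (Vbar A C Lstar Sstar W)
      ((LinearMap.toContinuousLinearMap g).comp Φ) L := by
    refine h1.congr_of_eventuallyEq (Eventually.of_forall fun L' => ?_)
    change (W * (Sstar + C * Sigmabar A C Lstar Sstar L' * Cᵀ)).trace
      = (W * Sstar).trace + (W * C * Sigmabar A C Lstar Sstar L' * Cᵀ).trace
    rw [Matrix.mul_add, Matrix.trace_add]
    simp only [Matrix.mul_assoc]
  rw [h2.fderiv]
  rfl

end helpers

/-- **Differentiability of `Σ̄` and the derivative of `V̄`.** For `ρ(A − LC) < 1` and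
`M = A − LC`, the map `Σ̄` is differentiable at `L`; its directional derivative `Σ̇` in a
direction `D` is the unique solution of `Σ̇ = M Σ̇ Mᵀ + D 𝒟ᵀ + 𝒟 Dᵀ` with
`𝒟 = (L − L*) S* − M Σ̄(L) Cᵀ`; the directional derivative of `V̄` equals `Tr(W C Σ̇ Cᵀ)`;
and for `D = 𝒟` one has `Σ̇ = M Σ̇ Mᵀ + 2 𝒟 𝒟ᵀ` and
`C Σ̇ Cᵀ = 2 ∑ᵢ (C Mⁱ 𝒟)(C Mⁱ 𝒟)ᵀ ⪰ 0`. -/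
theorem sigmabar_differentiable_directional_derivative {n q : ℕ}
    (A : Matrix (Fin n) (Fin n) ℝ) (C : Matrix (Fin q) (Fin n) ℝ)
    (Lstar : Matrix (Fin n) (Fin q) ℝ) (Sstar W : Matrix (Fin q) (Fin q) ℝ)
    (hS : Sstar.PosDef) (hW : W.PosDef)
    (L : Matrix (Fin n) (Fin q) ℝ) (hρ : specRadius (A - L * C) < 1) :
    ∃ Φ : Matrix (Fin n) (Fin q) ℝ →L[ℝ] Matrix (Fin n) (Fin n) ℝ,
      HasFDerivAt (fun L' => Sigmabar A C Lstar Sstar L') Φ L ∧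
      (∀ D : Matrix (Fin n) (Fin q) ℝ,
        Φ D = (A - L * C) * Φ D * (A - L * C)ᵀ
          + D * (Dcal A C Lstar Sstar L)ᵀ + Dcal A C Lstar Sstar L * Dᵀ) ∧
      (∀ D Y : _ ,
        Y = (A - L * C) * Y * (A - L * C)ᵀ
            + D * (Dcal A C Lstar Sstar L)ᵀ + Dcal A C Lstar Sstar L * Dᵀ
          → Y = Φ D) ∧
      (∀ D : Matrix (Fin n) (Fin q) ℝ,
        fderiv ℝ (Vbar A C Lstar Sstar W) L D = (W * C * Φ D * Cᵀ).trace) ∧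
      (Φ (Dcal A C Lstar Sstar L)
        = (A - L * C) * Φ (Dcal A C Lstar Sstar L) * (A - L * C)ᵀ
          + (2 : ℝ) • (Dcal A C Lstar Sstar L * (Dcal A C Lstar Sstar L)ᵀ)) ∧
      (C * Φ (Dcal A C Lstar Sstar L) * Cᵀ
        = (2 : ℝ) • ∑' i : ℕ,
            (C * (A - L * C) ^ i * Dcal A C Lstar Sstar L)
              * (C * (A - L * C) ^ i * Dcal A C Lstar Sstar L)ᵀ) ∧
      (C * Φ (Dcal A C Lstar Sstar L) * Cᵀ).PosSemidef := by
  have hS' : Sstarᵀ = Sstar := by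
    have := hS.isHermitian
    rwa [Matrix.IsHermitian, Matrix.conjTranspose_eq_transpose_of_trivial] at this
  obtain ⟨Φ, hΦ⟩ := aux_diff A C Lstar Sstar L hρ
  have key := aux_main_eq A C Lstar Sstar hS' L hρ Φ hΦ
  have key2 : Φ (Dcal A C Lstar Sstar L)
        = (A - L * C) * Φ (Dcal A C Lstar Sstar L) * (A - L * C)ᵀ
          + (2 : ℝ) • (Dcal A C Lstar Sstar L * (Dcal A C Lstar Sstar L)ᵀ) := by
    rw [two_smul, ← add_assoc]
    exact key _
  have hsum := aux_summable_map (A - L * C) hρ C (Dcal A C Lstar Sstar L)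
  have hly := aux_lyap (A - L * C) hρ (Dcal A C Lstar Sstar L * (Dcal A C Lstar Sstar L)ᵀ)
  have key3 : Φ (Dcal A C Lstar Sstar L) = (2 : ℝ) • ∑' i : ℕ, (A - L * C) ^ i *
      (Dcal A C Lstar Sstar L * (Dcal A C Lstar Sstar L)ᵀ) * (A - L * C)ᵀ ^ i := by
    refine aux_unique' _ hρ _ _ _ key2 ?_
    rw [Matrix.mul_smul, Matrix.smul_mul, ← smul_add]
    exact congrArg _ hly
  have key4 : C * Φ (Dcal A C Lstar Sstar L) * Cᵀ = (2 : ℝ) • (C * (∑' i : ℕ, (A - L * C) ^ i *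
      (Dcal A C Lstar Sstar L * (Dcal A C Lstar Sstar L)ᵀ) * (A - L * C)ᵀ ^ i) * Cᵀ) := by
    rw [key3, Matrix.mul_smul, Matrix.smul_mul]
  refine ⟨Φ, hΦ, key, ?_, aux_Vbar A C Lstar Sstar W L Φ hΦ, key2, ?_, ?_⟩
  · intro D Y hY
    refine aux_unique' _ hρ _ _ (D * (Dcal A C Lstar Sstar L)ᵀ + Dcal A C Lstar Sstar L * Dᵀ)
      ?_ ?_
    · rw [← add_assoc]; exact hY
    · rw [← add_assoc]; exact key D
  · rw [key4]
    exact congrArg _ hsum.tsum_eq.symm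
  · rw [key4]
    exact (aux_psd _ _ hsum).smul (by norm_num)
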